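/- arXiv:2106.14472 — 2 statements merged into one kernel-verified Lean document; each statement's English description precedes it below -/
import Mathlib

section
/- For d ≥ 4 and φ > d − 2, the integral over the open unit ball B_d of (1 − ‖z‖²)^{φ+1−d} / ‖e₁ − z‖² dz is finite, where e₁ is the first standard basis vector. -/
open MeasureTheory

/-- The power `u ↦ u ^ β`, cut off to the interval `(0, 1]`. -/
noncomputable def truncRpow (β : ℝ) : ℝ → ℝ :=
  (Set.Ioc (0 : ℝ) 1).indicator fun u => u ^ β

lemma truncRpow_of_mem {β u : ℝ} (h0 : 0 < u) (h1 : u ≤ 1) : truncRpow β u = u ^ β :=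
  Set.indicator_of_mem (Set.mem_Ioc.2 ⟨h0, h1⟩) _

lemma truncRpow_nonneg (β u : ℝ) : 0 ≤ truncRpow β u :=
  Set.indicator_nonneg (fun _ hu => Real.rpow_nonneg hu.1.le _) _

lemma measurable_truncRpow (β : ℝ) : Measurable (truncRpow β) :=
  (measurable_id.pow_const β).indicator measurableSet_Ioc

lemma integrable_truncRpow {β : ℝ} (hβ : -1 < β) : Integrable (truncRpow β) := by
  rw [truncRpow, integrable_indicator_iff measurableSet_Ioc,
    ← intervalIntegrable_iff_integrableOn_Ioc_of_le zero_le_one]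
  exact intervalIntegral.intervalIntegrable_rpow' hβ

lemma integrable_radial_truncRpow {n : ℕ} (hn : 3 ≤ n) {β : ℝ} (hβ : -1 < β) :
    Integrable fun x : EuclideanSpace ℝ (Fin n) => truncRpow β (1 - ‖x‖) * (‖x‖ ^ 2)⁻¹ := by
  have : Nonempty (Fin n) := ⟨⟨0, by omega⟩⟩
  rw [integrable_fun_norm_addHaar volume (f := fun r => truncRpow β (1 - r) * (r ^ 2)⁻¹)]
  have hm := measurable_truncRpow β
  refine ((integrable_truncRpow hβ).comp_sub_left 1).integrableOn.mono' ?_ ?_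
  · exact Measurable.aestronglyMeasurable (by fun_prop)
  · filter_upwards [ae_restrict_mem measurableSet_Ioi] with r (hr : 0 < r)
    obtain ⟨m, rfl⟩ : ∃ m, n = m + 3 := ⟨n - 3, by omega⟩
    have key : r ^ (m + 2) * (truncRpow β (1 - r) * (r ^ 2)⁻¹) = r ^ m * truncRpow β (1 - r) := by
      field_simp
      ring
    simp only [finrank_euclideanSpace_fin, Nat.add_succ_sub_one, smul_eq_mul]
    rw [key, Real.norm_of_nonneg (mul_nonneg (by positivity) (truncRpow_nonneg _ _))]
    by_cases h1 : r ≤ 1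
    · exact mul_le_of_le_one_left (truncRpow_nonneg _ _) (pow_le_one₀ hr.le h1)
    · have : truncRpow β (1 - r) = 0 :=
        Set.indicator_of_notMem (fun h => h1 (by linarith [h.1])) _
      simp [this]

/-- Splitting off the first coordinate of a Euclidean space. -/
noncomputable def headTail (n : ℕ) (z : EuclideanSpace ℝ (Fin (n + 1))) :
    ℝ × EuclideanSpace ℝ (Fin n) :=
  (z 0, WithLp.toLp 2 fun j => z j.succ)

lemma measurePreserving_headTail (n : ℕ) : MeasurePreserving (headTail n) :=
  (((MeasurePreserving.id volume).prod (PiLp.volume_preserving_toLp (Fin n))).comp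
    (volume_preserving_piFinSuccAbove (fun _ : Fin (n + 1) => ℝ) 0)).comp
    (PiLp.volume_preserving_ofLp (Fin (n + 1)))

lemma norm_sq_eq_headTail {n : ℕ} (z : EuclideanSpace ℝ (Fin (n + 1))) :
    ‖z‖ ^ 2 = (headTail n z).1 ^ 2 + ‖(headTail n z).2‖ ^ 2 := by
  simp [EuclideanSpace.real_norm_sq_eq, Fin.sum_univ_succ, headTail]

lemma norm_tail_sq_le {n : ℕ} (z : EuclideanSpace ℝ (Fin (n + 1))) :
    ‖(headTail n z).2‖ ^ 2 ≤ ‖EuclideanSpace.single (0 : Fin (n + 1)) (1 : ℝ) - z‖ ^ 2 := by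
  simp only [EuclideanSpace.real_norm_sq_eq, Fin.sum_univ_succ, headTail]
  simp
  positivity

/-- A product-type majorant of `(1 - ‖z‖ ^ 2) ^ β / ‖e₁ - z‖ ^ 2` in the coordinates `headTail`. -/
noncomputable def majorant (n : ℕ) (β : ℝ) (p : ℝ × EuclideanSpace ℝ (Fin n)) : ENNReal :=
  ENNReal.ofReal (truncRpow β (1 - ‖p.2‖) * (‖p.2‖ ^ 2)⁻¹) *
    (ENNReal.ofReal (truncRpow β (√(1 - ‖p.2‖ ^ 2) - p.1)) +
      ENNReal.ofReal (truncRpow β (√(1 - ‖p.2‖ ^ 2) + p.1)))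

lemma measurable_majorant (n : ℕ) (β : ℝ) : Measurable (majorant n β) := by
  have hm := measurable_truncRpow β
  unfold majorant
  fun_prop

lemma lintegral_majorant_lt_top {n : ℕ} (hn : 3 ≤ n) {β : ℝ} (hβ : -1 < β) :
    ∫⁻ p, majorant n β p < ⊤ := by
  have hm := measurable_truncRpow β
  rw [Measure.volume_eq_prod, lintegral_prod_symm' _ (measurable_majorant n β)]
  have inner (x : EuclideanSpace ℝ (Fin n)) : ∫⁻ t, majorant n β (t, x) =
      ENNReal.ofReal (truncRpow β (1 - ‖x‖) * (‖x‖ ^ 2)⁻¹) *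
        ((∫⁻ t, ENNReal.ofReal (truncRpow β t)) + ∫⁻ t, ENNReal.ofReal (truncRpow β t)) := by
    simp only [majorant]
    rw [lintegral_const_mul _ (by fun_prop), lintegral_add_left (by fun_prop),
      lintegral_sub_left_eq_self (fun t => ENNReal.ofReal (truncRpow β t)),
      lintegral_add_left_eq_self (fun t => ENNReal.ofReal (truncRpow β t))]
  simp only [inner]
  rw [lintegral_mul_const _ (by fun_prop)]
  have hfin := (integrable_truncRpow hβ).lintegral_lt_top
  exact ENNReal.mul_lt_top (integrable_radial_truncRpow hn hβ).lintegral_lt_top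
    (ENNReal.add_lt_top.2 ⟨hfin, hfin⟩)

lemma rpow_one_sub_le {β t r : ℝ} (hβ : β ≤ 0) (hr : 0 ≤ r) (h : t ^ 2 + r ^ 2 < 1) :
    (1 - (t ^ 2 + r ^ 2)) ^ β ≤ truncRpow β (1 - r) *
      (truncRpow β (√(1 - r ^ 2) - t) + truncRpow β (√(1 - r ^ 2) + t)) := by
  set ρ := √(1 - r ^ 2) with hρ
  have hρsq : ρ ^ 2 = 1 - r ^ 2 := Real.sq_sqrt (by nlinarith)
  have hρ0 : 0 ≤ ρ := Real.sqrt_nonneg _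
  have hρ1 : ρ ≤ 1 := by nlinarith
  have hr1 : r < 1 := by nlinarith
  have htρ : |t| < ρ := abs_lt_of_sq_lt_sq (by linarith) hρ0
  have hrρ : 1 - r ≤ ρ := by nlinarith
  have habs : (ρ - |t|) ^ β ≤ truncRpow β (ρ - t) + truncRpow β (ρ + t) := by
    have h1 := truncRpow_nonneg β (ρ - t)
    have h2 := truncRpow_nonneg β (ρ + t)
    rcases le_total 0 t with ht | ht
    · rw [abs_of_nonneg ht] at htρ ⊢
      rw [truncRpow_of_mem (u := ρ - t) (by linarith) (by linarith)]
      linarith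
    · rw [abs_of_nonpos ht] at htρ ⊢
      rw [truncRpow_of_mem (u := ρ + t) (by linarith) (by linarith), sub_neg_eq_add]
      linarith
  rw [truncRpow_of_mem (u := 1 - r) (by linarith) (by linarith)]
  have hprod : (1 - r) * (ρ - |t|) ≤ 1 - (t ^ 2 + r ^ 2) := by
    have : 1 - (t ^ 2 + r ^ 2) = (ρ + |t|) * (ρ - |t|) := by
      linear_combination -hρsq + sq_abs t
    rw [this]
    exact mul_le_mul_of_nonneg_right (by linarith [abs_nonneg t]) (by linarith)
  calc (1 - (t ^ 2 + r ^ 2)) ^ β ≤ ((1 - r) * (ρ - |t|)) ^ β :=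
        Real.rpow_le_rpow_of_nonpos (mul_pos (by linarith) (by linarith)) hprod hβ
    _ = (1 - r) ^ β * (ρ - |t|) ^ β := Real.mul_rpow (by linarith) (by linarith)
    _ ≤ _ := mul_le_mul_of_nonneg_left habs (Real.rpow_nonneg (by linarith) _)

lemma le_majorant {n : ℕ} {α β : ℝ} (hαβ : β ≤ α) (hβ : β ≤ 0)
    {z : EuclideanSpace ℝ (Fin (n + 1))} (hz : ‖z‖ < 1) (hx : (headTail n z).2 ≠ 0) :
    ENNReal.ofReal ((1 - ‖z‖ ^ 2) ^ α /
      ‖EuclideanSpace.single (0 : Fin (n + 1)) (1 : ℝ) - z‖ ^ 2) ≤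
      majorant n β (headTail n z) := by
  have hle := norm_tail_sq_le z
  have heq := norm_sq_eq_headTail z
  have hz2 : ‖z‖ ^ 2 < 1 := by nlinarith [norm_nonneg z]
  unfold majorant
  generalize headTail n z = p at *
  have hp : 0 < ‖p.2‖ := norm_pos_iff.2 hx
  have hmul := truncRpow_nonneg β (1 - ‖p.2‖)
  rw [← ENNReal.ofReal_add (truncRpow_nonneg _ _) (truncRpow_nonneg _ _),
    ← ENNReal.ofReal_mul (by positivity)]
  refine ENNReal.ofReal_le_ofReal ?_
  calc (1 - ‖z‖ ^ 2) ^ α / ‖EuclideanSpace.single (0 : Fin (n + 1)) (1 : ℝ) - z‖ ^ 2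
      ≤ (1 - ‖z‖ ^ 2) ^ β / ‖p.2‖ ^ 2 := by
        refine div_le_div₀ (Real.rpow_nonneg (by linarith) _) ?_ (by positivity) hle
        exact Real.rpow_le_rpow_of_exponent_ge (by linarith) (by linarith [sq_nonneg ‖z‖]) hαβ
    _ ≤ truncRpow β (1 - ‖p.2‖) * (truncRpow β (√(1 - ‖p.2‖ ^ 2) - p.1) +
          truncRpow β (√(1 - ‖p.2‖ ^ 2) + p.1)) / ‖p.2‖ ^ 2 := by
        rw [heq] at hz2 ⊢
        exact div_le_div_of_nonneg_right (rpow_one_sub_le hβ hp.le hz2) (by positivity)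
    _ = _ := by ring

theorem integral_finite_of_phi_gt {d : ℕ} (hd : 4 ≤ d) (φ : ℝ) (hφ : (d : ℝ) - 2 < φ) :
    ∫⁻ z in Metric.ball (0 : EuclideanSpace ℝ (Fin d)) 1,
        ENNReal.ofReal ((1 - ‖z‖ ^ 2) ^ (φ + 1 - d) /
          ‖EuclideanSpace.single (⟨0, by omega⟩ : Fin d) (1 : ℝ) - z‖ ^ 2) < ⊤ := by
  obtain ⟨n, rfl⟩ : ∃ n, d = n + 1 := ⟨d - 1, by omega⟩
  have hn : 3 ≤ n := by omega
  have : Nonempty (Fin n) := ⟨⟨0, by omega⟩⟩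
  set α : ℝ := φ + 1 - (n + 1 : ℕ) with hα
  have hβ : -1 < min α 0 := lt_min (by linarith) (by norm_num)
  have hmp := measurePreserving_headTail n
  have hne : ∀ᵐ z : EuclideanSpace ℝ (Fin (n + 1)), (headTail n z).2 ≠ 0 := by
    refine hmp.quasiMeasurePreserving.ae (p := fun q => q.2 ≠ 0) ?_
    exact Measure.quasiMeasurePreserving_snd.ae (p := fun x => x ≠ 0) (Measure.ae_ne volume 0)
  calc _ ≤ ∫⁻ z in Metric.ball (0 : EuclideanSpace ℝ (Fin (n + 1))) 1,
          majorant n (min α 0) (headTail n z) := by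
        refine lintegral_mono_ae ?_
        filter_upwards [ae_restrict_mem Metric.isOpen_ball.measurableSet,
          ae_restrict_of_ae hne] with z hz hz0
        exact le_majorant (min_le_left _ _) (min_le_right _ _) (mem_ball_zero_iff.1 hz) hz0
    _ ≤ ∫⁻ z, majorant n (min α 0) (headTail n z) := setLIntegral_le_lintegral _ _
    _ = ∫⁻ p, majorant n (min α 0) p := hmp.lintegral_comp (measurable_majorant n _)
    _ < ⊤ := lintegral_majorant_lt_top hn hβ
end

section
/- Let ℓ(z, p) = log(‖p − z‖²/(1 − ‖z‖²)) − φ·log(1 − ‖z‖²) for z in the open unit ball B_d and p a unit vector, and let dV = 2^d (1 − ‖z‖²)^{−d} dz be the hyperbolic volume element. Then for d ≥ 4, the integral ∫_{B_d} exp(−ℓ(z,p)) dV is finite if and only if φ > d − 2. -/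
open MeasureTheory Real

noncomputable def busemannLoss {d : ℕ} (φ : ℝ) (z p : EuclideanSpace ℝ (Fin d)) : ℝ :=
  Real.log (‖p - z‖ ^ 2 / (1 - ‖z‖ ^ 2)) - φ * Real.log (1 - ‖z‖ ^ 2)

open Set Metric Module

section PolarCoordinates

variable {E : Type*} [NormedAddCommGroup E] [NormedSpace ℝ E] [FiniteDimensional ℝ E]
  [MeasurableSpace E] [BorelSpace E] (μ : Measure E) [μ.IsAddHaarMeasure]

theorem lintegral_eq_lintegral_toSphere_lintegral_Ioi [Nontrivial E] {f : E → ENNReal}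
    (hf : Measurable f) :
    ∫⁻ x, f x ∂μ = ∫⁻ ω : sphere (0 : E) 1, (∫⁻ r in Ioi (0 : ℝ),
      ENNReal.ofReal (r ^ (finrank ℝ E - 1)) * f (r • (ω : E))) ∂μ.toSphere := by
  have hpolar := μ.measurePreserving_homeomorphUnitSphereProd.lintegral_comp_emb
    (Homeomorph.measurableEmbedding _) fun x ↦ f ((x.2 : ℝ) • (x.1 : E))
  have hinv (x : ({0}ᶜ : Set E)) : ((homeomorphUnitSphereProd E x).2 : ℝ) •
      ((homeomorphUnitSphereProd E x).1 : E) = x :=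
    congrArg Subtype.val ((homeomorphUnitSphereProd E).symm_apply_apply x)
  simp only [hinv] at hpolar
  rw [lintegral_subtype_comap (measurableSet_singleton _).compl, restrict_compl_singleton,
    lintegral_prod _ (by fun_prop)] at hpolar
  rw [hpolar]
  refine lintegral_congr fun ω ↦ ?_
  rw [Measure.volumeIoiPow, lintegral_withDensity_eq_lintegral_mul _ (by fun_prop) (by fun_prop),
    ← lintegral_subtype_comap measurableSet_Ioi]
  rfl

theorem ae_toSphere_coe_ne (hE : 1 < finrank ℝ E) (p : E) :
    ∀ᵐ ω : sphere (0 : E) 1 ∂μ.toSphere, (ω : E) ≠ p := by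
  have hmeas : MeasurableSet {ω : sphere (0 : E) 1 | (ω : E) = p} :=
    measurable_subtype_coe (measurableSet_singleton p)
  have hspan : Submodule.span ℝ {p} ≠ ⊤ := by
    intro h
    have := finrank_span_le_card (R := ℝ) {p}
    rw [h, finrank_top] at this
    simp at this
    omega
  rw [ae_iff]
  simp only [ne_eq, not_not]
  rw [μ.toSphere_apply' hmeas]
  refine mul_eq_zero_of_right _ (measure_mono_null ?_ (μ.addHaar_submodule _ hspan))
  rintro _ ⟨r, -, _, ⟨ω, hω, rfl⟩, rfl⟩
  rw [← show (ω : E) = p from hω]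
  exact Submodule.smul_mem _ r (Submodule.mem_span_singleton_self _)

theorem lintegral_toSphere_inv_norm_sub_sq_lt_top (hE : 3 < finrank ℝ E) {p : E}
    (hp : ‖p‖ = 1) :
    ∫⁻ ω : sphere (0 : E) 1, ENNReal.ofReal ((‖p - ω‖ ^ 2)⁻¹) ∂μ.toSphere < ⊤ := by
  have : Nontrivial E := nontrivial_of_finrank_pos (R := ℝ) (by omega)
  set n := finrank ℝ E - 1
  let g : E → ENNReal := (ball 0 2).indicator fun x ↦ ENNReal.ofReal (‖x‖ ^ (-3 : ℝ))
  have hg : Measurable g := Measurable.indicator (by fun_prop) measurableSet_ball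
  have hfin : ∫⁻ z, g (p - z) ∂μ < ⊤ := by
    rw [lintegral_sub_left_eq_self g p, lintegral_indicator measurableSet_ball]
    have hint : IntegrableOn (fun x : E ↦ ‖x‖ ^ (-3 : ℝ)) (ball 0 2) μ :=
      integrableOn_ball_of_norm_le_rpow (C := 1) (α := 3) (by omega) (by exact_mod_cast hE)
        (.of_forall fun x ↦ by simp)
        (Measurable.aestronglyMeasurable (by fun_prop))
    exact hint.lintegral_lt_top
  rw [lintegral_eq_lintegral_toSphere_lintegral_Ioi μ (by fun_prop)] at hfin
  set C : ℝ := (1 / 2) ^ n / 32 with hC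
  have hCpos : 0 < C := by positivity
  have hle (ω : sphere (0 : E) 1) : ENNReal.ofReal C * ENNReal.ofReal ((‖p - ω‖ ^ 2)⁻¹) ≤
      ∫⁻ r in Ioi (0 : ℝ), ENNReal.ofReal (r ^ n) * g (p - r • (ω : E)) := by
    have hω : ‖(ω : E)‖ = 1 := norm_eq_of_mem_sphere ω
    set t := ‖p - (ω : E)‖ with ht
    have ht2 : t ≤ 2 := by linarith [norm_sub_le p (ω : E)]
    have ht0 : 0 ≤ t := norm_nonneg _
    rcases ht0.eq_or_lt with h0 | ht0
    · simp [← h0]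
    calc ENNReal.ofReal C * ENNReal.ofReal ((t ^ 2)⁻¹)
        = ∫⁻ r in Ioo (1 - t / 4) 1, ENNReal.ofReal ((1 / 2) ^ n * (2 * t) ^ (-3 : ℝ)) := by
          rw [setLIntegral_const, Real.volume_Ioo, ← ENNReal.ofReal_mul (by positivity),
            ← ENNReal.ofReal_mul (by positivity)]
          congr 1
          rw [hC, rpow_neg (by positivity)]
          norm_cast
          field_simp
          ring
      _ ≤ ∫⁻ r in Ioo (1 - t / 4) 1, ENNReal.ofReal (r ^ n) * g (p - r • (ω : E)) := by
          refine setLIntegral_mono' measurableSet_Ioo fun r ⟨hr1, hr2⟩ ↦ ?_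
          have hr : 1 / 2 ≤ r := by linarith
          have hrω : ‖r • (ω : E)‖ = r := by rw [norm_smul, hω, norm_of_nonneg] <;> linarith
          have hdiff : ‖(ω : E) - r • (ω : E)‖ = 1 - r := by
            rw [show (ω : E) - r • (ω : E) = (1 - r) • (ω : E) by module, norm_smul, hω,
              norm_of_nonneg] <;> linarith
          have hpos : 0 < ‖p - r • (ω : E)‖ := by
            linarith [norm_sub_norm_le p (r • (ω : E))]
          have hlt : ‖p - r • (ω : E)‖ < 2 := by linarith [norm_sub_le p (r • (ω : E))]
          have hle : ‖p - r • (ω : E)‖ ≤ 2 * t := by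
            linarith [norm_sub_le_norm_sub_add_norm_sub p (ω : E) (r • (ω : E))]
          rw [show g (p - r • (ω : E)) = ENNReal.ofReal (‖p - r • (ω : E)‖ ^ (-3 : ℝ)) from
            indicator_of_mem (by simpa using hlt) _, ← ENNReal.ofReal_mul (by positivity)]
          apply ENNReal.ofReal_le_ofReal
          have := rpow_le_rpow_of_nonpos hpos hle (by norm_num : (-3 : ℝ) ≤ 0)
          gcongr
      _ ≤ _ := lintegral_mono_set fun r hr ↦ by
          simp only [mem_Ioo, mem_Ioi] at *; linarith
  have := (lintegral_mono hle).trans_lt hfin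
  rw [lintegral_const_mul' _ _ ENNReal.ofReal_ne_top] at this
  exact ENNReal.lt_top_of_mul_ne_top_right this.ne (by simpa using hCpos)

end PolarCoordinates

theorem integrableOn_one_sub_rpow_iff {a c : ℝ} (hc : c < 1) :
    IntegrableOn (fun r : ℝ ↦ (1 - r) ^ a) (Ioo c 1) ↔ -1 < a := by
  have h := (Measure.measurePreserving_sub_left volume (1 : ℝ)).integrableOn_comp_preimage
    (MeasurableEquiv.subLeft (1 : ℝ)).measurableEmbedding (f := fun s : ℝ ↦ s ^ a)
    (s := Ioo 0 (1 - c))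
  rw [intervalIntegral.integrableOn_Ioo_rpow_iff (by linarith)] at h
  rw [← h, preimage_const_sub_Ioo]
  simp [Function.comp_def]

theorem integrableOn_pow_mul_one_sub_sq_rpow_iff (n : ℕ) {a : ℝ} :
    IntegrableOn (fun r : ℝ ↦ r ^ n * (1 - r ^ 2) ^ a) (Ioo 0 1) ↔ -1 < a := by
  have hfactor {r : ℝ} (h0 : 0 < r) (h1 : r < 1) :
      (1 - r ^ 2) ^ a = (1 + r) ^ a * (1 - r) ^ a := by
    rw [← mul_rpow (by linarith) (by linarith)]; ring_nf
  have hupper {r : ℝ} (h0 : 0 < r) (h1 : r < 1) : (1 + r) ^ a ≤ 2 ^ |a| :=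
    (rpow_le_rpow_of_exponent_le (by linarith) (le_abs_self a)).trans
      (rpow_le_rpow (by linarith) (by linarith) (abs_nonneg a))
  have hlower {r : ℝ} (h0 : 0 < r) (h1 : r < 1) : 2 ^ (-|a|) ≤ (1 + r) ^ a :=
    (rpow_le_rpow_of_nonpos (by linarith) (by linarith) (by simp)).trans
      (rpow_le_rpow_of_exponent_le (by linarith) (neg_abs_le a))
  constructor
  · intro h
    rw [← integrableOn_one_sub_rpow_iff (show (1 / 2 : ℝ) < 1 by norm_num)]
    have h' := (h.mono_set (Ioo_subset_Ioo_left (by norm_num : (0 : ℝ) ≤ 1 / 2))).const_mul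
      (((1 / 2) ^ n * 2 ^ (-|a|))⁻¹)
    refine h'.mono' (Measurable.aestronglyMeasurable (by fun_prop)) ?_
    filter_upwards [ae_restrict_mem measurableSet_Ioo] with r ⟨hr0, hr1⟩
    have h1r : 0 ≤ 1 - r := by linarith
    rw [norm_of_nonneg (by positivity), hfactor (by linarith) hr1,
      le_inv_mul_iff₀ (by positivity), ← mul_assoc]
    have := hlower (by linarith) hr1
    gcongr
  · intro h
    have h' := ((integrableOn_one_sub_rpow_iff zero_lt_one).2 h).const_mul (2 ^ |a|)
    refine h'.mono' (Measurable.aestronglyMeasurable (by fun_prop)) ?_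
    filter_upwards [ae_restrict_mem measurableSet_Ioo] with r ⟨hr0, hr1⟩
    have h1r : 0 ≤ 1 - r := by linarith
    have h1r2 : 0 ≤ 1 - r ^ 2 := by nlinarith
    rw [norm_of_nonneg (by positivity)]
    calc r ^ n * (1 - r ^ 2) ^ a ≤ 1 * (1 - r ^ 2) ^ a := by
          gcongr; exact pow_le_one₀ hr0.le hr1.le
      _ = (1 + r) ^ a * (1 - r) ^ a := by rw [one_mul, hfactor hr0 hr1]
      _ ≤ _ := by gcongr; exact hupper hr0 hr1

section Ball

variable {E : Type*} [NormedAddCommGroup E] [NormedSpace ℝ E] [FiniteDimensional ℝ E]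
  [MeasurableSpace E] [BorelSpace E] (μ : Measure E) [μ.IsAddHaarMeasure]

theorem lintegral_ball_one_sub_norm_sq_rpow_div_lt_top_iff (hE : 3 < finrank ℝ E) {p : E}
    (hp : ‖p‖ = 1) {a : ℝ} :
    ∫⁻ z in ball (0 : E) 1, ENNReal.ofReal ((1 - ‖z‖ ^ 2) ^ a / ‖p - z‖ ^ 2) ∂μ < ⊤ ↔
      -1 < a := by
  have : Nontrivial E := nontrivial_of_finrank_pos (R := ℝ) (by omega)
  set n := finrank ℝ E - 1 with hn
  constructor
  · intro h
    have hint : IntegrableOn (fun z : E ↦ (1 - ‖z‖ ^ 2) ^ a / ‖p - z‖ ^ 2) (ball 0 1) μ := by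
      refine ⟨Measurable.aestronglyMeasurable (by fun_prop), ?_⟩
      rwa [hasFiniteIntegral_iff_ofReal]
      filter_upwards [ae_restrict_mem measurableSet_ball] with z hz
      rw [mem_ball_zero_iff] at hz
      have : 0 ≤ 1 - ‖z‖ ^ 2 := by nlinarith [norm_nonneg z]
      simp only [Pi.zero_apply]
      positivity
    rw [← integrableOn_pow_mul_one_sub_sq_rpow_iff n]
    refine (integrableOn_fun_norm_addHaar μ (f := fun r ↦ (1 - r ^ 2) ^ a)).1 ?_
    refine (hint.const_mul 4).mono' (Measurable.aestronglyMeasurable (by fun_prop)) ?_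
    filter_upwards [ae_restrict_mem measurableSet_ball] with z hz
    rw [mem_ball_zero_iff] at hz
    have h0 : 0 ≤ 1 - ‖z‖ ^ 2 := by nlinarith [norm_nonneg z]
    have hlt : ‖p - z‖ ≤ 2 := by linarith [norm_sub_le p z]
    have hpos : 0 < ‖p - z‖ := by linarith [norm_sub_norm_le p z]
    rw [norm_of_nonneg (by positivity), ← mul_div_assoc, le_div_iff₀ (by positivity), mul_comm]
    gcongr
    nlinarith
  · intro ha
    have hradial : ∫⁻ r in Ioo (0 : ℝ) 1, ENNReal.ofReal (r ^ n * (1 - r ^ 2) ^ a) < ⊤ :=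
      ((integrableOn_pow_mul_one_sub_sq_rpow_iff n).2 ha).lintegral_lt_top
    rw [← lintegral_indicator measurableSet_ball,
      lintegral_eq_lintegral_toSphere_lintegral_Ioi μ
        (Measurable.indicator (by fun_prop) measurableSet_ball), ← hn]
    refine (lintegral_mono_ae (g := fun ω : sphere (0 : E) 1 ↦
      ENNReal.ofReal ((‖p - ω‖ ^ 2)⁻¹) *
        (4 * ∫⁻ r in Ioo (0 : ℝ) 1, ENNReal.ofReal (r ^ n * (1 - r ^ 2) ^ a))) ?_).trans_lt ?_
    · filter_upwards [ae_toSphere_coe_ne μ (by omega) p] with ω hωp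
      have hω : ‖(ω : E)‖ = 1 := norm_eq_of_mem_sphere ω
      have ht : 0 < ‖p - (ω : E)‖ := norm_pos_iff.2 (sub_ne_zero.2 hωp.symm)
      rw [← mul_assoc, ← lintegral_const_mul' _ _ (by finiteness),
        ← lintegral_indicator measurableSet_Ioo, ← lintegral_indicator measurableSet_Ioi]
      refine lintegral_mono fun r ↦ ?_
      by_cases hr0 : 0 < r
      swap
      · simp [hr0]
      have hrω : ‖r • (ω : E)‖ = r := by rw [norm_smul, hω, norm_of_nonneg hr0.le, mul_one]
      by_cases hr1 : r < 1
      swap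
      · simp [hrω, hr1]
      have hdiff : ‖r • (ω : E) - (ω : E)‖ = 1 - r := by
        rw [norm_sub_rev, show (ω : E) - r • (ω : E) = (1 - r) • (ω : E) by module, norm_smul, hω,
          norm_of_nonneg] <;> linarith
      have hle : ‖p - (ω : E)‖ ≤ 2 * ‖p - r • (ω : E)‖ := by
        linarith [norm_sub_le_norm_sub_add_norm_sub p (r • (ω : E)) (ω : E),
          norm_sub_norm_le p (r • (ω : E))]
      have hpos : 0 < ‖p - r • (ω : E)‖ := by linarith
      have h0 : 0 ≤ 1 - r ^ 2 := by nlinarith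
      rw [indicator_of_mem (mem_Ioi.2 hr0), indicator_of_mem (mem_Ioo.2 ⟨hr0, hr1⟩),
        indicator_of_mem (by simpa [hrω] using hr1), hrω,
        show (4 : ENNReal) = ENNReal.ofReal 4 by simp, ← ENNReal.ofReal_mul (by positivity),
        ← ENNReal.ofReal_mul (by positivity), ← ENNReal.ofReal_mul (by positivity)]
      apply ENNReal.ofReal_le_ofReal
      have hinv : (‖p - r • (ω : E)‖ ^ 2)⁻¹ ≤ (‖p - (ω : E)‖ ^ 2)⁻¹ * 4 := by
        rw [inv_mul_eq_div, inv_le_comm₀ (by positivity) (by positivity), inv_div,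
          div_le_iff₀ (by norm_num)]
        nlinarith
      calc r ^ n * ((1 - r ^ 2) ^ a / ‖p - r • (ω : E)‖ ^ 2)
          = (‖p - r • (ω : E)‖ ^ 2)⁻¹ * (r ^ n * (1 - r ^ 2) ^ a) := by ring
        _ ≤ _ := by gcongr
    · rw [lintegral_mul_const' _ _ (by finiteness)]
      exact ENNReal.mul_lt_top (lintegral_toSphere_inv_norm_sub_sq_lt_top μ hE hp) (by finiteness)

end Ball

theorem exp_neg_busemannLoss_mul_volume_density {d : ℕ} (φ : ℝ) {z p : EuclideanSpace ℝ (Fin d)}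
    (hp : ‖p‖ = 1) (hz : ‖z‖ < 1) :
    Real.exp (-(busemannLoss φ z p)) * (2 ^ d * (1 - ‖z‖ ^ 2) ^ (-(d : ℝ))) =
      2 ^ d * ((1 - ‖z‖ ^ 2) ^ (1 + φ - d) / ‖p - z‖ ^ 2) := by
  have h0 : 0 < 1 - ‖z‖ ^ 2 := by nlinarith [norm_nonneg z]
  have hpos : 0 < ‖p - z‖ := by linarith [norm_sub_norm_le p z]
  have hexp : Real.exp (-(busemannLoss φ z p)) =
      (1 - ‖z‖ ^ 2) / ‖p - z‖ ^ 2 * (1 - ‖z‖ ^ 2) ^ φ := by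
    rw [busemannLoss, neg_sub, sub_eq_add_neg, Real.exp_add, ← Real.log_inv,
      Real.exp_log (by positivity), inv_div, rpow_def_of_pos h0, mul_comm φ, mul_comm]
  rw [hexp, sub_eq_add_neg (1 + φ), rpow_add h0, rpow_add h0, rpow_one]
  ring

theorem normalization_finite_iff {d : ℕ} (hd : 4 ≤ d) (φ : ℝ)
    (p : EuclideanSpace ℝ (Fin d)) (hp : ‖p‖ = 1) :
    (∫⁻ z in Metric.ball (0 : EuclideanSpace ℝ (Fin d)) 1,
        ENNReal.ofReal (Real.exp (-(busemannLoss φ z p)) *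
          (2 ^ d * (1 - ‖z‖ ^ 2) ^ (-(d : ℝ)))) < ⊤) ↔ (d : ℝ) - 2 < φ := by
  have hfin : 3 < finrank ℝ (EuclideanSpace ℝ (Fin d)) := by
    rw [finrank_euclideanSpace_fin]; omega
  rw [setLIntegral_congr_fun measurableSet_ball fun z hz ↦ by
      rw [exp_neg_busemannLoss_mul_volume_density φ hp (mem_ball_zero_iff.1 hz),
        ENNReal.ofReal_mul (by positivity)],
    lintegral_const_mul' _ _ ENNReal.ofReal_ne_top]
  refine Iff.trans ⟨fun h ↦ ENNReal.lt_top_of_mul_ne_top_right h.ne (by positivity),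
    ENNReal.mul_lt_top ENNReal.ofReal_lt_top⟩ <|
    (lintegral_ball_one_sub_norm_sq_rpow_div_lt_top_iff volume hfin hp).trans ?_
  constructor <;> intro h <;> linarith
end
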